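/- Consider an L₂²-biased game with utilities T_r(x, y) = xᵀRy − ‖x − p‖₂² and T_c(x, y) = xᵀCy − ‖y − q‖₂² (i.e. d_r = d_c = 1), where R, C have entries in [0,1] and p, q ∈ Δⁿ. Let y* ∈ Δⁿ be a best response of the column player against p (a maximizer of T_c(p, ·)), let x ∈ Δⁿ be a best response of the row player against y* (a maximizer of T_r(·, y*)), and let x* = (5/7)·p + (2/7)·x. Then (x*, y*) is a 5/7-equilibrium: T_r(x̃, y*) ≤ T_r(x*, y*) + 5/7 for every x̃ ∈ Δⁿ, and T_c(x*, ỹ) ≤ T_c(x*, y*) + 5/7 for every ỹ ∈ Δⁿ. -/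

import Mathlib

open Finset Matrix

/-- Row player's utility in an `L₂²`-biased game with `d_r = 1`: `xᵀRy − ‖x − p‖₂²`. -/
noncomputable def TrL2 {n : ℕ} (R : Matrix (Fin n) (Fin n) ℝ) (p : Fin n → ℝ)
    (x y : Fin n → ℝ) : ℝ := x ⬝ᵥ R.mulVec y - ∑ i, (x i - p i) ^ 2

/-- Column player's utility in an `L₂²`-biased game with `d_c = 1`: `xᵀCy − ‖y − q‖₂²`. -/
noncomputable def TcL2 {n : ℕ} (C : Matrix (Fin n) (Fin n) ℝ) (q : Fin n → ℝ)
    (x y : Fin n → ℝ) : ℝ := x ⬝ᵥ C.mulVec y - ∑ i, (y i - q i) ^ 2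

/-- A bilinear form with coefficients in `[0, 1]` takes values in `[0, 1]` on pairs of
mixed strategies. -/
theorem dotProduct_mulVec_mem_Icc {n : ℕ} {A : Matrix (Fin n) (Fin n) ℝ}
    (hA : ∀ i j, A i j ∈ Set.Icc (0 : ℝ) 1) {x y : Fin n → ℝ}
    (hx : x ∈ stdSimplex ℝ (Fin n)) (hy : y ∈ stdSimplex ℝ (Fin n)) :
    x ⬝ᵥ A.mulVec y ∈ Set.Icc (0 : ℝ) 1 := by
  have hAy0 : ∀ i, 0 ≤ A.mulVec y i := fun i =>
    Finset.sum_nonneg (s := Finset.univ) fun j _ => mul_nonneg (hA i j).1 (hy.1 j)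
  have hAy1 : ∀ i, A.mulVec y i ≤ 1 := fun i => by
    rw [← hy.2]
    exact Finset.sum_le_sum (s := Finset.univ) fun j _ => mul_le_of_le_one_left (hy.1 j) (hA i j).2
  refine ⟨Finset.sum_nonneg fun i _ => mul_nonneg (hx.1 i) (hAy0 i), ?_⟩
  rw [← hx.2]
  exact Finset.sum_le_sum fun i _ => mul_le_of_le_one_right (hx.1 i) (hAy1 i)

/-- the base algorithm gives a `5/7`-equilibrium in `L₂²`-biased games with
`d_r = d_c = 1`: if `y*` is a best response against `p`, `x` a best response against `y*`,
and `x* = (5/7)·p + (2/7)·x`, then `(x*, y*)` is a `5/7`-equilibrium. -/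
theorem L2sq_biased_five_sevenths_equilibrium {n : ℕ}
    (R C : Matrix (Fin n) (Fin n) ℝ)
    (hR : ∀ i j, R i j ∈ Set.Icc (0 : ℝ) 1) (hC : ∀ i j, C i j ∈ Set.Icc (0 : ℝ) 1)
    (p q : Fin n → ℝ) (hp : p ∈ stdSimplex ℝ (Fin n)) (hq : q ∈ stdSimplex ℝ (Fin n))
    (ystar : Fin n → ℝ) (hystar : ystar ∈ stdSimplex ℝ (Fin n))
    (hbrc : ∀ y ∈ stdSimplex ℝ (Fin n), TcL2 C q p y ≤ TcL2 C q p ystar)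
    (x : Fin n → ℝ) (hx : x ∈ stdSimplex ℝ (Fin n))
    (hbrr : ∀ z ∈ stdSimplex ℝ (Fin n), TrL2 R p z ystar ≤ TrL2 R p x ystar)
    (xstar : Fin n → ℝ) (hxstar : xstar = (5 / 7 : ℝ) • p + (2 / 7 : ℝ) • x) :
    (∀ xt ∈ stdSimplex ℝ (Fin n),
      TrL2 R p xt ystar ≤ TrL2 R p xstar ystar + 5 / 7) ∧
    (∀ yt ∈ stdSimplex ℝ (Fin n),
      TcL2 C q xstar yt ≤ TcL2 C q xstar ystar + 5 / 7) := by
  subst hxstar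
  have hnonneg : ∀ a b : Fin n → ℝ, 0 ≤ ∑ i, (a i - b i) ^ 2 := fun a b =>
    Finset.sum_nonneg fun i _ => sq_nonneg _
  refine ⟨fun xt hxt => ?_, fun yt hyt => ?_⟩
  · have hdist : ∑ i, (((5 / 7 : ℝ) • p + (2 / 7 : ℝ) • x) i - p i) ^ 2
        = (4 / 49) * ∑ i, (x i - p i) ^ 2 := by
      rw [Finset.mul_sum]
      refine Finset.sum_congr rfl fun i _ => ?_
      simp only [Pi.add_apply, Pi.smul_apply, smul_eq_mul]
      ring
    have hbest := hbrr xt hxt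
    have hp0 := (dotProduct_mulVec_mem_Icc hR hp hystar).1
    have hx1 := (dotProduct_mulVec_mem_Icc hR hx hystar).2
    have hD := hnonneg x p
    unfold TrL2 at *
    rw [hdist, add_dotProduct, smul_dotProduct, smul_dotProduct, smul_eq_mul, smul_eq_mul]
    linarith
  · have hbest := hbrc yt hyt
    have hbest_q := hbrc q hq
    have hpq := (dotProduct_mulVec_mem_Icc hC hp hq).1
    have hpy := (dotProduct_mulVec_mem_Icc hC hp hystar).2
    have hxy := (dotProduct_mulVec_mem_Icc hC hx hystar).1
    have hxyt := (dotProduct_mulVec_mem_Icc hC hx hyt).2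
    have hyt_q := hnonneg yt q
    unfold TcL2 at *
    simp only [sub_self, ne_eq, OfNat.ofNat_ne_zero, not_false_eq_true, zero_pow,
      Finset.sum_const_zero, sub_zero] at hbest_q
    simp only [add_dotProduct, smul_dotProduct, smul_eq_mul]
    linarith
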